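/- For every X : Fin n → K, letting x : Fin n × Fin b → ZMod 2 be its blockwise basic binary image, x(j,f) = Φ_B(X j)(f), one has H_B *ᵥ x = 0 if and only if H_q *ᵥ X = 0. Consequently, the basic binary image C_B = {blockwise Φ_B image of X : X in the nullspace of H_q} equals the nullspace of H_B. -/

import Mathlib

open Matrix

/-- For every `X : Fin n → K`, the blockwise basic binary image
`x (j, f) = Φ_B (X j) f` satisfies `H_B *ᵥ x = 0` iff `H_q *ᵥ X = 0`; consequently the
basic binary image `C_B` (the blockwise `Φ_B` image of the nullspace of `H_q`) equals the
nullspace of `H_B`. -/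
theorem basic_binary_image_eq_nullspace (b m n : ℕ) (hb : 1 ≤ b)
    (ΦB : GaloisField 2 b ≃ₗ[ZMod 2] (Fin b → ZMod 2))
    (Ψm : GaloisField 2 b → Matrix (Fin b) (Fin b) (ZMod 2))
    (hΨm : ∀ (h x : GaloisField 2 b), Ψm h *ᵥ ΦB x = ΦB (h * x))
    (Hq : Matrix (Fin m) (Fin n) (GaloisField 2 b))
    (HB : Matrix (Fin m × Fin b) (Fin n × Fin b) (ZMod 2))
    (hHB : ∀ (i : Fin m) (e : Fin b) (j : Fin n) (f : Fin b),
      HB (i, e) (j, f) = Ψm (Hq i j) e f) :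
    (∀ X : Fin n → GaloisField 2 b,
      HB *ᵥ (fun jf : Fin n × Fin b => ΦB (X jf.1) jf.2) = 0 ↔ Hq *ᵥ X = 0) ∧
    {x : Fin n × Fin b → ZMod 2 |
        ∃ X : Fin n → GaloisField 2 b, Hq *ᵥ X = 0 ∧
          x = fun jf : Fin n × Fin b => ΦB (X jf.1) jf.2} =
      {x : Fin n × Fin b → ZMod 2 | HB *ᵥ x = 0} := by
  have key : ∀ (X : Fin n → GaloisField 2 b) (i : Fin m) (e : Fin b),
      (HB *ᵥ (fun jf : Fin n × Fin b => ΦB (X jf.1) jf.2)) (i, e) = ΦB ((Hq *ᵥ X) i) e := by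
    intro X i e
    simp only [Matrix.mulVec, dotProduct, Fintype.sum_prod_type, hHB, map_sum,
      Finset.sum_apply]
    refine Finset.sum_congr rfl fun j _ => ?_
    rw [← hΨm]
    rfl
  have main : ∀ X : Fin n → GaloisField 2 b,
      HB *ᵥ (fun jf : Fin n × Fin b => ΦB (X jf.1) jf.2) = 0 ↔ Hq *ᵥ X = 0 := by
    intro X
    constructor
    · intro h
      funext i
      apply ΦB.injective
      funext e
      rw [← key, h]
      simp
    · intro h
      funext ⟨i, e⟩
      rw [key, h]
      simp
  refine ⟨main, ?_⟩
  ext x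
  constructor
  · rintro ⟨X, hX, rfl⟩
    exact (main X).2 hX
  · intro hx
    have hx' : x = fun jf : Fin n × Fin b =>
        ΦB ((fun j => ΦB.symm (fun f => x (j, f))) jf.1) jf.2 := by
      funext ⟨j, f⟩
      simp
    refine ⟨fun j => ΦB.symm (fun f => x (j, f)), (main _).1 ?_, hx'⟩
    rw [← hx']
    exact hx
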